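/- arXiv:1803.01552 — 14 statements merged into one kernel-verified Lean document; each statement's English description precedes it below -/
import Mathlib

section
/- Let P and Q be partially ordered sets and let f : P → Q and g : Q → P be monotone functions. If the composite g ∘ f has a least prefixed point μ (i.e., μ is the least element of {p ∈ P : g(f(p)) ≤ p}), then f(μ) is the least prefixed point of f ∘ g, i.e., f(μ) is the least element of {q ∈ Q : f(g(q)) ≤ q} (and it is a fixed point of f ∘ g). -/
/-- Rolling lemma: if `μ` is the least prefixed point of `g ∘ f`, then `f μ` is
the least prefixed point of `f ∘ g`, and it is a fixed point of `f ∘ g`. -/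
theorem rolling {P Q : Type*} [PartialOrder P] [PartialOrder Q]
    (f : P → Q) (g : Q → P) (hf : Monotone f) (hg : Monotone g)
    (μ : P) (hμ : IsLeast {p : P | g (f p) ≤ p} μ) :
    IsLeast {q : Q | f (g q) ≤ q} (f μ) ∧ f (g (f μ)) = f μ := by
  have fixed : g (f μ) = μ :=
    le_antisymm hμ.1 (hμ.2 (hg (hf hμ.1)))
  have fixed_image : f (g (f μ)) = f μ := congrArg f fixed
  exact ⟨⟨fixed_image.le, fun _ hq => (hf (hμ.2 (hg hq))).trans hq⟩, fixed_image⟩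
end

section
/- Let P be a partially ordered set and f : P × P → P a function monotone in each coordinate (with the product order). Suppose that for each x ∈ P the function y ↦ f(x,y) has a least prefixed point m(x), and that the (monotone) function x ↦ m(x) has a least prefixed point μ. Then μ is the least prefixed point of the diagonal function x ↦ f(x,x). -/
/-- A parametrized least prefixed point is monotone in the parameter. -/
theorem monotone_of_isLeast_prefixed {P Q : Type*} [Preorder P] [Preorder Q]
    {f : P → Q → Q} (hf : ∀ y, Monotone fun x => f x y)
    {m : P → Q} (hm : ∀ x, IsLeast {y : Q | f x y ≤ y} (m x)) : Monotone m :=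
  fun _ y hxy => (hm _).2 ((hf (m y) hxy).trans (hm y).1)

/-- A least prefixed point of a monotone function is a fixed point. -/
theorem IsLeast.isFixedPt_of_monotone {P : Type*} [PartialOrder P] {h : P → P}
    (hh : Monotone h) {μ : P} (hμ : IsLeast {x : P | h x ≤ x} μ) : Function.IsFixedPt h μ :=
  le_antisymm hμ.1 (hμ.2 (hh hμ.1))

/-- Diagonal rule: if for each `x` the map `y ↦ f x y` has a least prefixed point
`m x`, and `m` has a least prefixed point `μ`, then `μ` is the least prefixed point
of the diagonal `x ↦ f x x`. -/
theorem diagonal {P : Type*} [PartialOrder P]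
    (f : P → P → P) (hf : Monotone fun p : P × P => f p.1 p.2)
    (m : P → P) (hm : ∀ x, IsLeast {y : P | f x y ≤ y} (m x))
    (μ : P) (hμ : IsLeast {x : P | m x ≤ x} μ) :
    IsLeast {x : P | f x x ≤ x} μ := by
  have hm_mono : Monotone m :=
    monotone_of_isLeast_prefixed (f := f) (fun _ _ _ hxy => hf (Prod.mk_le_mk.2 ⟨hxy, le_rfl⟩)) hm
  refine ⟨?_, fun x hx => hμ.2 ((hm x).2 hx)⟩
  have h : f μ (m μ) ≤ m μ := (hm μ).1
  rwa [hμ.isFixedPt_of_monotone hm_mono] at h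
end

section
/- (Bekić) Let P and Q be posets and let ⟨f,g⟩ : P × Q → P × Q be monotone, where f : P × Q → P and g : P × Q → Q. Suppose: (a) for each x ∈ P the function y ↦ g(x,y) has a least prefixed point, denoted μ_y.g(x,y); (b) the function x ↦ f(x, μ_y.g(x,y)) has a least prefixed point μ₁; and (c) the function y ↦ g(μ₁, y) has a least prefixed point μ₂. Then (μ₁, μ₂) is the least prefixed point of ⟨f,g⟩ in P × Q with the coordinatewise order. -/
/-- Bekić's lemma: least prefixed points of a monotone pair `⟨f,g⟩` can be computed
componentwise. -/
theorem bekic {P Q : Type*} [PartialOrder P] [PartialOrder Q]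
    (f : P × Q → P) (g : P × Q → Q)
    (hfg : Monotone fun p : P × Q => (f p, g p))
    (m : P → Q) (hm : ∀ x : P, IsLeast {y : Q | g (x, y) ≤ y} (m x))
    (μ₁ : P) (hμ₁ : IsLeast {x : P | f (x, m x) ≤ x} μ₁)
    (μ₂ : Q) (hμ₂ : IsLeast {y : Q | g (μ₁, y) ≤ y} μ₂) :
    IsLeast {p : P × Q | (f p, g p) ≤ p} (μ₁, μ₂) := by
  obtain rfl : m μ₁ = μ₂ := (hm μ₁).unique hμ₂
  refine ⟨⟨hμ₁.1, hμ₂.1⟩, ?_⟩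
  rintro ⟨x, y⟩ ⟨hf, hg⟩
  have hmy : m x ≤ y := (hm x).2 hg
  have hx : μ₁ ≤ x := hμ₁.2 ((hfg (Prod.mk_le_mk.2 ⟨le_rfl, hmy⟩)).1.trans hf)
  exact ⟨hx, hμ₂.2 ((hfg (Prod.mk_le_mk.2 ⟨hx, le_rfl⟩)).2.trans hg)⟩
end

section
/- Every polynomial function f on a Heyting algebra H is compatible: for all x, y ∈ H, x ⊓ f(y) = x ⊓ f(x ⊓ y). In particular, every monotone polynomial function on H is strong: x ⊓ f(y) ≤ f(x ⊓ y) for all x, y ∈ H. -/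
/-- Polynomial functions on a Heyting algebra: the smallest set of functions
`H → H` containing the identity and all constants, closed under pointwise
meet, join and Heyting implication. -/
inductive IsPolynomial {H : Type*} [HeytingAlgebra H] : (H → H) → Prop
  | id : IsPolynomial (fun x => x)
  | const (a : H) : IsPolynomial (fun _ => a)
  | inf {f g : H → H} : IsPolynomial f → IsPolynomial g →
      IsPolynomial (fun x => f x ⊓ g x)
  | sup {f g : H → H} : IsPolynomial f → IsPolynomial g →
      IsPolynomial (fun x => f x ⊔ g x)
  | himp {f g : H → H} : IsPolynomial f → IsPolynomial g →
      IsPolynomial (fun x => f x ⇨ g x)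

theorem inf_himp_eq_inf_himp_inf_inf {H : Type*} [HeytingAlgebra H] (x a b : H) :
    x ⊓ (a ⇨ b) = x ⊓ (x ⊓ a ⇨ x ⊓ b) := by
  rw [himp_inf_distrib, himp_eq_top_iff.2 inf_le_left, top_inf_eq, ← himp_himp, inf_himp]

theorem IsPolynomial.inf_apply_eq {H : Type*} [HeytingAlgebra H] {f : H → H}
    (hf : IsPolynomial f) (x y : H) : x ⊓ f y = x ⊓ f (x ⊓ y) := by
  induction hf with
  | id => exact inf_left_idem x y |>.symm
  | const a => rfl
  | inf _ _ hf hg => rw [inf_inf_distrib_left, hf, hg, ← inf_inf_distrib_left]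
  | sup _ _ hf hg => rw [inf_sup_left, hf, hg, ← inf_sup_left]
  | himp _ _ hf hg =>
    rw [inf_himp_eq_inf_himp_inf_inf, hf, hg, ← inf_himp_eq_inf_himp_inf_inf]

/-- Every polynomial on a Heyting algebra is compatible; in particular every
monotone polynomial is strong. -/
theorem polynomial_compatible {H : Type*} [HeytingAlgebra H]
    (f : H → H) (hf : IsPolynomial f) :
    (∀ x y : H, x ⊓ f y = x ⊓ f (x ⊓ y)) ∧
      (Monotone f → ∀ x y : H, x ⊓ f y ≤ f (x ⊓ y)) := by
  exact ⟨hf.inf_apply_eq, fun _ x y => (hf.inf_apply_eq x y).trans_le inf_le_right⟩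
end

section
/- Let H be a Heyting algebra, f : H → H a strong monotone function with least prefixed point μ, and a ∈ H. Then: (1) a ⇨ μ is the least prefixed point of the function x ↦ a ⇨ f(x); and (2) a ⊓ μ is the least prefixed point of the function x ↦ a ⊓ f(x). -/
/-- For a strong monotone `f` with least prefixed point `μ` and any `a`:
`a ⇨ μ` is the least prefixed point of `x ↦ a ⇨ f x`, and `a ⊓ μ` is the least
prefixed point of `x ↦ a ⊓ f x`. -/
theorem lfp_himp_inf {H : Type*} [HeytingAlgebra H]
    (f : H → H) (hmono : Monotone f)
    (hstrong : ∀ x y : H, x ⊓ f y ≤ f (x ⊓ y))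
    (μ : H) (hμ : IsLeast {x : H | f x ≤ x} μ) (a : H) :
    IsLeast {x : H | a ⇨ f x ≤ x} (a ⇨ μ) ∧
      IsLeast {x : H | a ⊓ f x ≤ x} (a ⊓ μ) := by
  have hpre : f μ ≤ μ := hμ.1
  have hleast : ∀ {x : H}, f x ≤ x → μ ≤ x := fun hx => hμ.2 hx
  have hpost : μ ≤ f μ := hleast (hmono hpre)
  have hf : ∀ x : H, a ⊓ f (a ⇨ x) ≤ f x := fun x =>
    (hstrong a (a ⇨ x)).trans (hmono inf_himp_le)
  refine ⟨⟨?_, fun x hx => ?_⟩, ⟨?_, fun x hx => ?_⟩⟩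
  · exact le_himp_iff'.2 (le_inf inf_le_left inf_himp_le |>.trans ((hf μ).trans hpre))
  · have hμx : μ ≤ x := hleast (le_himp.trans hx)
    exact (himp_le_himp_left (hpost.trans (hmono hμx))).trans hx
  · exact inf_le_inf_left a ((hmono inf_le_right).trans hpre)
  · have hpre_himp : f (a ⇨ x) ≤ a ⇨ x :=
      le_himp_iff'.2 ((le_inf inf_le_left (hf x)).trans hx)
    exact le_himp_iff'.1 (hleast hpre_himp)
end

section
/- Let H be a Heyting algebra and let f₁, …, fₙ (n ≥ 1) be strong monotone functions on H, each fᵢ having a least prefixed point μᵢ. Then the pointwise meet μ₁ ⊓ ⋯ ⊓ μₙ is the least prefixed point of the function x ↦ f₁(x) ⊓ ⋯ ⊓ fₙ(x). -/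
/-- The least prefixed point of a strong monotone function satisfies induction in any context. -/
theorem lfp_inf_le_of_strong {H : Type*} [HeytingAlgebra H] {f : H → H} (hmono : Monotone f)
    (hstrong : ∀ x y : H, x ⊓ f y ≤ f (x ⊓ y)) {m : H} (hm : IsLeast {x : H | f x ≤ x} m)
    {a p : H} (h : f p ⊓ a ≤ p) : m ⊓ a ≤ p := by
  refine le_himp_iff.mp (hm.2 (le_himp_iff.mpr ?_))
  refine le_trans (le_inf ?_ inf_le_right) h
  rw [inf_comm]
  exact (hstrong _ _).trans (hmono inf_himp_le)

/-- Contextual induction for the meet of the least prefixed points of a finite family of strong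
monotone functions. -/
theorem inf_lfp_inf_le_of_strong {H ι : Type*} [HeytingAlgebra H] {f : ι → H → H}
    (hmono : ∀ i, Monotone (f i)) (hstrong : ∀ i, ∀ x y : H, x ⊓ f i y ≤ f i (x ⊓ y))
    {μ : ι → H} (hμ : ∀ i, IsLeast {x : H | f i x ≤ x} (μ i)) {p : H} (s : Finset ι) (a : H)
    (h : (s.inf fun i => f i p) ⊓ a ≤ p) : (s.inf fun i => μ i) ⊓ a ≤ p := by
  induction s using Finset.cons_induction generalizing a with
  | empty => exact h
  | cons i s hi ih =>
    rw [Finset.inf_cons, inf_assoc] at h ⊢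
    have hs := lfp_inf_le_of_strong (hmono i) (hstrong i) (hμ i) h
    rw [inf_left_comm] at hs ⊢
    exact ih _ hs

/-- The least prefixed point of a finite pointwise meet of strong monotone
functions is the meet of the least prefixed points. -/
theorem lfp_finite_inf {H : Type*} [HeytingAlgebra H]
    (n : ℕ) (hn : 1 ≤ n) (f : Fin n → H → H)
    (hmono : ∀ i, Monotone (f i))
    (hstrong : ∀ i, ∀ x y : H, x ⊓ f i y ≤ f i (x ⊓ y))
    (μ : Fin n → H) (hμ : ∀ i, IsLeast {x : H | f i x ≤ x} (μ i)) :
    IsLeast {x : H | (Finset.univ.inf fun i => f i x) ≤ x}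
      (Finset.univ.inf fun i => μ i) := by
  refine ⟨Finset.inf_mono_fun fun i hi => ?_, fun p hp => ?_⟩
  · exact (hmono i (Finset.inf_le hi)).trans (hμ i).1
  · have h := inf_lfp_inf_le_of_strong hmono hstrong hμ Finset.univ ⊤ (inf_le_left.trans hp)
    rwa [inf_top_eq] at h
end

section
/- Let P be a join-semilattice and let f, g : P → P be monotone inflating functions (i.e., x ≤ f(x) and x ≤ g(x) for all x). Then the set of prefixed points of the pointwise join x ↦ f(x) ⊔ g(x) coincides with the set of prefixed points of the composite f ∘ g. Consequently, for any monotone h : P → P, an element is the least prefixed point of x ↦ f(x) ⊔ g(x) ⊔ h(x) if and only if it is the least prefixed point of x ↦ f(g(x)) ⊔ h(x). -/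
/-- A prefixed point of the pointwise join of inflating functions, the outer one monotone, is the
same thing as a prefixed point of their composite. -/
theorem sup_le_self_iff_comp_le_self {P : Type*} [SemilatticeSup P] {f g : P → P}
    (hf : Monotone f) (hf' : ∀ x, x ≤ f x) (hg' : ∀ x, x ≤ g x) (p : P) :
    f p ⊔ g p ≤ p ↔ f (g p) ≤ p := by
  rw [sup_le_iff]
  exact ⟨fun ⟨hfp, hgp⟩ => (hf hgp).trans hfp,
    fun hp => ⟨(hf (hg' p)).trans hp, (hf' (g p)).trans hp⟩⟩

/-- For monotone inflating functions `f`, `g` on a join-semilattice, the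
prefixed points of the pointwise join `f ⊔ g` coincide with the prefixed points
of `f ∘ g`; consequently, for any monotone `h`, the least prefixed points of
`x ↦ f x ⊔ g x ⊔ h x` and `x ↦ f (g x) ⊔ h x` coincide. -/
theorem prefixed_sup_eq_prefixed_comp {P : Type*} [SemilatticeSup P]
    (f g : P → P) (hf : Monotone f) (hg : Monotone g)
    (hf' : ∀ x, x ≤ f x) (hg' : ∀ x, x ≤ g x) :
    {p : P | f p ⊔ g p ≤ p} = {p : P | f (g p) ≤ p} ∧
      ∀ h : P → P, Monotone h → ∀ μ : P,
        (IsLeast {p : P | f p ⊔ g p ⊔ h p ≤ p} μ ↔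
          IsLeast {p : P | f (g p) ⊔ h p ≤ p} μ) := by
  have key := sup_le_self_iff_comp_le_self hf hf' hg'
  refine ⟨Set.ext key, fun h _ μ => ?_⟩
  have heq : {p : P | f p ⊔ g p ⊔ h p ≤ p} = {p : P | f (g p) ⊔ h p ≤ p} := by
    ext p
    rw [Set.mem_ofPred_eq, Set.mem_ofPred_eq, sup_le_iff, key, ← sup_le_iff]
  rw [heq]
end

section
/- Let H be a Heyting algebra and let φ : H → H be a disjunctive function with associated finite head set Head(φ) ⊆ H and side set Side(φ) ⊆ H. Then the least prefixed point of φ exists and equals (⨅_{a ∈ Head(φ)} a) ⇨ (⨆_{b ∈ Side(φ)} b), where the empty meet is ⊤ and the empty join is ⊥. -/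
/-- Disjunctive functions on a Heyting algebra, together with their head set
and side set. -/
inductive Disjunctive {H : Type*} [HeytingAlgebra H] [DecidableEq H] :
    (H → H) → Finset H → Finset H → Prop
  | id : Disjunctive (fun x => x) ∅ ∅
  | himp (a : H) {φ : H → H} {Hd Sd : Finset H} :
      Disjunctive φ Hd Sd → Disjunctive (fun x => a ⇨ φ x) (insert a Hd) Sd
  | side (b : H) {φ : H → H} {Hd Sd : Finset H} :
      Disjunctive φ Hd Sd → Disjunctive (fun x => b ⊔ φ x) Hd (insert b Sd)
  | sup {φ₁ φ₂ : H → H} {Hd₁ Sd₁ Hd₂ Sd₂ : Finset H} :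
      Disjunctive φ₁ Hd₁ Sd₁ → Disjunctive φ₂ Hd₂ Sd₂ →
      Disjunctive (fun x => φ₁ x ⊔ φ₂ x) (Hd₁ ∪ Hd₂) (Sd₁ ∪ Sd₂)

namespace Disjunctive

variable {H : Type*} [HeytingAlgebra H] [DecidableEq H] {φ : H → H} {Hd Sd : Finset H}

/-- Disjunctive functions are inflationary. -/
theorem le_apply (hφ : Disjunctive φ Hd Sd) (x : H) : x ≤ φ x := by
  induction hφ with
  | id => exact le_rfl
  | himp a _ ih => exact ih.trans le_himp
  | side b _ ih => exact ih.trans le_sup_right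
  | sup _ _ ih₁ _ => exact ih₁.trans le_sup_left

/-- Every element of the side set lies below every value of the function. -/
theorem side_le_apply (hφ : Disjunctive φ Hd Sd) (x : H) : ∀ b ∈ Sd, b ≤ φ x := by
  induction hφ with
  | id => simp
  | himp a _ ih => exact fun b hb => (ih b hb).trans le_himp
  | side b _ ih =>
    intro c hc
    rcases Finset.mem_insert.1 hc with rfl | hc
    · exact le_sup_left
    · exact (ih c hc).trans le_sup_right
  | sup _ _ ih₁ ih₂ =>
    intro b hb
    rcases Finset.mem_union.1 hb with hb | hb
    · exact (ih₁ b hb).trans le_sup_left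
    · exact (ih₂ b hb).trans le_sup_right

theorem head_himp_le_apply (hφ : Disjunctive φ Hd Sd) (x : H) : ∀ a ∈ Hd, a ⇨ x ≤ φ x := by
  induction hφ with
  | id => simp
  | himp a hφ ih =>
    intro c hc
    rcases Finset.mem_insert.1 hc with rfl | hc
    · exact himp_le_himp_left (hφ.le_apply x)
    · exact (ih c hc).trans le_himp
  | side b _ ih => exact fun a ha => (ih a ha).trans le_sup_right
  | sup _ _ ih₁ ih₂ =>
    intro a ha
    rcases Finset.mem_union.1 ha with ha | ha
    · exact (ih₁ a ha).trans le_sup_left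
    · exact (ih₂ a ha).trans le_sup_right

/-- If `m` lies below all heads and `s` above all sides, then `m ⇨ s` is a prefixed point. -/
theorem apply_himp_le (hφ : Disjunctive φ Hd Sd) {m s : H} (hm : ∀ a ∈ Hd, m ≤ a)
    (hs : ∀ b ∈ Sd, b ≤ s) : φ (m ⇨ s) ≤ m ⇨ s := by
  induction hφ with
  | id => exact le_rfl
  | himp a _ ih =>
    calc a ⇨ _ ≤ a ⇨ m ⇨ s :=
          himp_le_himp_left (ih (fun c hc => hm c (Finset.mem_insert_of_mem hc)) hs)
      _ = m ⇨ s := by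
          rw [himp_himp, inf_eq_right.2 (hm a (Finset.mem_insert_self _ _))]
  | side b _ ih =>
    exact sup_le ((hs b (Finset.mem_insert_self _ _)).trans le_himp)
      (ih hm fun c hc => hs c (Finset.mem_insert_of_mem hc))
  | sup _ _ ih₁ ih₂ =>
    exact sup_le
      (ih₁ (fun a ha => hm a (Finset.mem_union_left _ ha))
        fun b hb => hs b (Finset.mem_union_left _ hb))
      (ih₂ (fun a ha => hm a (Finset.mem_union_right _ ha))
        fun b hb => hs b (Finset.mem_union_right _ hb))

end Disjunctive

theorem Finset.inf_id_himp_le {H : Type*} [HeytingAlgebra H] [DecidableEq H] {x : H}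
    (s : Finset H) (h : ∀ a ∈ s, a ⇨ x ≤ x) : s.inf id ⇨ x ≤ x := by
  induction s using Finset.induction_on with
  | empty => simp
  | insert a s _ ih =>
    rw [Finset.inf_insert, id, ← himp_himp]
    exact (himp_le_himp_left (ih fun c hc => h c (Finset.mem_insert_of_mem hc))).trans
      (h a (Finset.mem_insert_self _ _))

/-- The least prefixed point of a disjunctive function `φ` is
`(⨅ Head(φ)) ⇨ (⨆ Side(φ))`. -/
theorem lfp_disjunctive {H : Type*} [HeytingAlgebra H] [DecidableEq H]
    (φ : H → H) (Hd Sd : Finset H) (hφ : Disjunctive φ Hd Sd) :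
    IsLeast {x : H | φ x ≤ x} ((Hd.inf id) ⇨ (Sd.sup id)) := by
  refine ⟨hφ.apply_himp_le (fun a ha => Finset.inf_le (f := id) ha)
    fun b hb => Finset.le_sup (f := id) hb, fun x (hx : φ x ≤ x) => ?_⟩
  calc Hd.inf id ⇨ Sd.sup id ≤ Hd.inf id ⇨ x :=
        himp_le_himp_left (Finset.sup_le fun b hb => (hφ.side_le_apply x b hb).trans hx)
    _ ≤ x := Hd.inf_id_himp_le fun a ha => (hφ.head_himp_le_apply x a ha).trans hx
end

section
/- Let P and Q be posets with least elements, and let f : P → Q and g : Q → P be monotone. If for some n ≥ 0 the element (f ∘ g)^n(⊥_Q) is the least prefixed point of f ∘ g : Q → Q, then (g ∘ f)^{n+1}(⊥_P) is the least prefixed point of g ∘ f : P → P. In other words, the closure ordinal of g ∘ f is at most 1 plus the closure ordinal of f ∘ g. -/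
/-- Convergence for the rolling rule: if `(f ∘ g)^n(⊥)` is the least prefixed
point of `f ∘ g`, then `(g ∘ f)^(n+1)(⊥)` is the least prefixed point of
`g ∘ f`. -/
theorem rolling_convergence {P Q : Type*}
    [PartialOrder P] [OrderBot P] [PartialOrder Q] [OrderBot Q]
    (f : P → Q) (g : Q → P) (hf : Monotone f) (hg : Monotone g) (n : ℕ)
    (h : IsLeast {q : Q | f (g q) ≤ q} ((f ∘ g)^[n] ⊥)) :
    IsLeast {p : P | g (f p) ≤ p} ((g ∘ f)^[n + 1] ⊥) := by
  have hfg : Monotone (f ∘ g) := hf.comp hg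
  have h_pre : f (g ((f ∘ g)^[n] ⊥)) ≤ (f ∘ g)^[n] ⊥ := h.1
  have h_upper : (f ∘ g)^[n] (f ⊥) ≤ (f ∘ g)^[n] ⊥ :=
    calc (f ∘ g)^[n] (f ⊥) ≤ (f ∘ g)^[n] ((f ∘ g)^[n] ⊥) :=
          hfg.iterate n ((hf bot_le).trans h_pre)
      _ ≤ (f ∘ g)^[n] ⊥ := hfg.antitone_iterate_of_map_le h_pre n.zero_le
  have h_eq : (g ∘ f)^[n + 1] ⊥ = g ((f ∘ g)^[n] ⊥) := by
    have h_semiconj : Function.Semiconj g (f ∘ g) (g ∘ f) := fun _ => rfl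
    rw [← h_upper.antisymm (hfg.iterate n bot_le), (h_semiconj.iterate_right n).eq,
      Function.iterate_succ_apply, Function.comp_apply]
  refine ⟨?_, fun p hp => ?_⟩
  · rw [h_eq]
    exact hg h_pre
  · have h_le : (f ∘ g)^[n] ⊥ ≤ f p := h.2 (hf hp)
    rw [h_eq]
    exact (hg h_le).trans hp
end

section
/- Let P and Q be posets with least elements, and let ⟨f,g⟩ : P × Q → P × Q be monotone, with f : P × Q → P and g : P × Q → Q. For x ∈ P write g_x for the map y ↦ g(x,y), and define h(x) = f(x, μ_y.g(x,y)). Suppose m, n ≥ 0 are such that for every x ∈ P the element g_x^m(⊥) is the least prefixed point of g_x, and h^n(⊥) is the least prefixed point of h. Then ⟨f,g⟩^{(n+1)(m+1)−1}(⊥,⊥) is the least prefixed point of ⟨f,g⟩; that is, cl(⟨f,g⟩) ≤ (n+1)(m+1) − 1. -/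
theorem Monotone.iterate_bot_le_of_map_le {α : Type*} [PartialOrder α] [OrderBot α]
    {F : α → α} (hF : Monotone F) {a : α} (ha : F a ≤ a) (k : ℕ) : F^[k] ⊥ ≤ a := by
  induction k with
  | zero => exact bot_le
  | succ k ih =>
    rw [Function.iterate_succ_apply']
    exact (hF ih).trans ha

/-- Convergence for Bekić's rule: if each `g_x` converges in `m` steps and
`h : x ↦ f (x, μ_y.g(x,y))` converges in `n` steps, then `⟨f,g⟩` converges in
`(n+1)(m+1) - 1` steps. -/
theorem bekic_convergence {P Q : Type*}
    [PartialOrder P] [OrderBot P] [PartialOrder Q] [OrderBot Q]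
    (f : P × Q → P) (g : P × Q → Q)
    (hfg : Monotone fun p : P × Q => (f p, g p))
    (m n : ℕ)
    (hg : ∀ x : P, IsLeast {y : Q | g (x, y) ≤ y} ((fun y => g (x, y))^[m] ⊥))
    (hh : IsLeast {x : P | f (x, (fun y => g (x, y))^[m] ⊥) ≤ x}
      ((fun x : P => f (x, (fun y => g (x, y))^[m] ⊥))^[n] ⊥)) :
    IsLeast {p : P × Q | (f p, g p) ≤ p}
      ((fun p : P × Q => (f p, g p))^[(n + 1) * (m + 1) - 1] ⊥) := by
  set F : P × Q → P × Q := fun p => (f p, g p)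
  have hf {p q : P × Q} (h : p ≤ q) : f p ≤ f q := (hfg h).1
  have hg' {p q : P × Q} (h : p ≤ q) : g p ≤ g q := (hfg h).2
  have hmono : Monotone fun k => F^[k] ⊥ :=
    hfg.monotone_iterate_of_le_map bot_le
  have inner {x : P} {k : ℕ} (hx : x ≤ (F^[k] ⊥).1) (j : ℕ) :
      (fun y => g (x, y))^[j] ⊥ ≤ (F^[k + j] ⊥).2 := by
    induction j with
    | zero => exact bot_le
    | succ j ih =>
      rw [Function.iterate_succ_apply', ← add_assoc, Function.iterate_succ_apply']
      exact hg' ⟨hx.trans (hmono (Nat.le_add_right k j)).1, ih⟩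
  have outer (j : ℕ) : (fun x : P => f (x, (fun y => g (x, y))^[m] ⊥))^[j] ⊥ ≤
      (F^[j * (m + 1)] ⊥).1 := by
    induction j with
    | zero => exact bot_le
    | succ j ih =>
      rw [Function.iterate_succ_apply', Nat.succ_mul, ← add_assoc, Function.iterate_succ_apply']
      exact hf ⟨ih.trans (hmono (Nat.le_add_right _ m)).1, inner ih m⟩
  have hk : (n + 1) * (m + 1) - 1 = n * (m + 1) + m := by
    rw [Nat.succ_mul, ← add_assoc, Nat.add_sub_cancel]
  rw [hk]
  refine ⟨?_, fun p hp => hfg.iterate_bot_le_of_map_le hp _⟩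
  set x := (fun x : P => f (x, (fun y => g (x, y))^[m] ⊥))^[n] ⊥
  have hpre : F (x, (fun y => g (x, y))^[m] ⊥) ≤ (x, (fun y => g (x, y))^[m] ⊥) :=
    ⟨hh.1, (hg x).1⟩
  have heq : F^[n * (m + 1) + m] ⊥ = (x, (fun y => g (x, y))^[m] ⊥) :=
    le_antisymm (hfg.iterate_bot_le_of_map_le hpre _)
      ⟨(outer n).trans (hmono (Nat.le_add_right _ m)).1, inner (outer n) m⟩
  rw [heq]
  exact hpre
end

section
/- Let P be a poset with a least element and f : P × P → P monotone in each coordinate. Define h(x) = μ_y.f(x,y), and suppose m, n ≥ 0 are such that for every x ∈ P the element f_x^m(⊥) is the least prefixed point of f_x : y ↦ f(x,y), and h^n(⊥) is the least prefixed point of h. Then d^{nm}(⊥) is the least prefixed point of the diagonal function d : x ↦ f(x,x); that is, cl(f ∘ Δ) ≤ cl(h) · m. -/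
/-- Iterates of a monotone map from `⊥` lie below every prefixed point. -/
theorem Monotone.iterate_bot_le_of_map_le_s13 {P : Type*} [PartialOrder P] [OrderBot P]
    {g : P → P} (hg : Monotone g) {x : P} (hx : g x ≤ x) (k : ℕ) : g^[k] ⊥ ≤ x := by
  induction k with
  | zero => exact bot_le
  | succ k ih =>
    rw [Function.iterate_succ_apply']
    exact (hg ih).trans hx

/-- If `x` lies below the `k`-th diagonal iterate, then `i` steps of `f x` from `⊥` stay below
the `(k + i)`-th diagonal iterate. -/
theorem iterate_bot_le_iterate_diagonal {P : Type*} [PartialOrder P] [OrderBot P]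
    {f : P → P → P} (hf : Monotone fun p : P × P => f p.1 p.2) {x : P} {k : ℕ}
    (hx : x ≤ (fun x : P => f x x)^[k] ⊥) (i : ℕ) :
    (f x)^[i] ⊥ ≤ (fun x : P => f x x)^[k + i] ⊥ := by
  have hd : Monotone fun x : P => f x x := fun a b h => hf (Prod.mk_le_mk.2 ⟨h, h⟩)
  induction i with
  | zero => exact bot_le
  | succ i ih =>
    rw [← Nat.add_assoc, Function.iterate_succ_apply', Function.iterate_succ_apply']
    have hchain := hd.monotone_iterate_of_le_map (x := ⊥) bot_le (Nat.le_add_right k i)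
    exact hf (Prod.mk_le_mk.2 ⟨hx.trans hchain, ih⟩)

/-- Convergence for the diagonal rule: if each `f_x : y ↦ f x y` converges in
`m` steps to its least prefixed point and `h : x ↦ μ_y.f(x,y)` converges in `n`
steps, then the diagonal `x ↦ f x x` converges in `n * m` steps. -/
theorem diagonal_convergence {P : Type*} [PartialOrder P] [OrderBot P]
    (f : P → P → P) (hf : Monotone fun p : P × P => f p.1 p.2)
    (m n : ℕ)
    (hfx : ∀ x : P, IsLeast {y : P | f x y ≤ y} ((f x)^[m] ⊥))
    (hh : IsLeast {x : P | (f x)^[m] ⊥ ≤ x} ((fun x : P => (f x)^[m] ⊥)^[n] ⊥)) :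
    IsLeast {x : P | f x x ≤ x} ((fun x : P => f x x)^[n * m] ⊥) := by
  have hd : Monotone fun x : P => f x x := fun a b h => hf (Prod.mk_le_mk.2 ⟨h, h⟩)
  have hle : ∀ j : ℕ, (fun x : P => (f x)^[m] ⊥)^[j] ⊥ ≤ (fun x : P => f x x)^[j * m] ⊥ := by
    intro j
    induction j with
    | zero => exact bot_le
    | succ j ih =>
      rw [Function.iterate_succ_apply', Nat.succ_mul]
      exact iterate_bot_le_iterate_diagonal hf ih m
  have hn := hle n
  generalize (fun x : P => (f x)^[m] ⊥)^[n] ⊥ = a at hh hn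
  have ha : (f a)^[m] ⊥ ≤ a := hh.1
  have hmono : (f ((f a)^[m] ⊥))^[m] ⊥ ≤ (f a)^[m] ⊥ :=
    (hfx _).2 ((hf (Prod.mk_le_mk.2 ⟨ha, le_rfl⟩)).trans (hfx a).1)
  have hfix : (f a)^[m] ⊥ = a := ha.antisymm (hh.2 hmono)
  have hpre : f a a ≤ a := by
    have h := (hfx a).1
    rwa [hfix] at h
  have heq := (hd.iterate_bot_le_of_map_le_s13 hpre (n * m)).antisymm hn
  rw [heq]
  exact ⟨hpre, fun x hx => heq ▸ hd.iterate_bot_le_of_map_le_s13 hx (n * m)⟩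
end

section
/- Let H be a Heyting algebra and let f, g : H → H be strong monotone functions. For all natural numbers n, m with n + m ≥ 1, f^n(⊥) ⊓ g^m(⊥) ≤ (f ⊓ g)^{n+m−1}(⊥), where f ⊓ g denotes the pointwise meet x ↦ f(x) ⊓ g(x). -/
/-- For strong monotone `f`, `g` on a Heyting algebra and `n + m ≥ 1`,
`f^n(⊥) ⊓ g^m(⊥) ≤ (f ⊓ g)^(n+m-1)(⊥)`. -/
theorem inf_iterates_le {H : Type*} [HeytingAlgebra H]
    (f g : H → H) (hf : Monotone f) (hg : Monotone g)
    (hf' : ∀ x y : H, x ⊓ f y ≤ f (x ⊓ y))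
    (hg' : ∀ x y : H, x ⊓ g y ≤ g (x ⊓ y))
    (n m : ℕ) (hnm : 1 ≤ n + m) :
    f^[n] ⊥ ⊓ g^[m] ⊥ ≤ (fun x => f x ⊓ g x)^[n + m - 1] ⊥ := by
  obtain ⟨k, hk⟩ : ∃ k, n + m = k + 1 := Nat.exists_eq_add_of_le' hnm
  rw [hk, Nat.add_sub_cancel]
  clear hnm
  induction k generalizing n m with
  | zero =>
    obtain rfl | rfl : n = 0 ∨ m = 0 := by omega
    all_goals simp
  | succ k ih =>
    rcases n with _ | n
    · simp
    rcases m with _ | m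
    · simp
    rw [Function.iterate_succ_apply' (fun x => f x ⊓ g x)]
    refine le_inf ?_ ?_
    · calc f^[n + 1] ⊥ ⊓ g^[m + 1] ⊥ = g^[m + 1] ⊥ ⊓ f (f^[n] ⊥) := by
            rw [inf_comm, Function.iterate_succ_apply' f]
        _ ≤ f (g^[m + 1] ⊥ ⊓ f^[n] ⊥) := hf' _ _
        _ ≤ _ := hf (inf_comm (g^[m + 1] ⊥) _ ▸ ih n (m + 1) (by omega))
    · calc f^[n + 1] ⊥ ⊓ g^[m + 1] ⊥ = f^[n + 1] ⊥ ⊓ g (g^[m] ⊥) := by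
            rw [Function.iterate_succ_apply' g]
        _ ≤ g (f^[n + 1] ⊥ ⊓ g^[m] ⊥) := hg' _ _
        _ ≤ _ := hg (ih (n + 1) m (by omega))
end

section
/- Let H be a Heyting algebra, g : H → H a strong monotone function, and e, f, c, x ∈ H. Suppose g(c) ≤ c, f ≤ c ≤ e ⇨ f, and c ≤ x ≤ e ⇨ f. Then (x ⇨ e) ⇨ f is a prefixed point of g: g((x ⇨ e) ⇨ f) ≤ (x ⇨ e) ⇨ f. -/
/-- Almost-topologies preserve prefixed points of strong monotone functions:
if `g c ≤ c`, `f ≤ c ≤ e ⇨ f` and `c ≤ x ≤ e ⇨ f`, then `(x ⇨ e) ⇨ f` is a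
prefixed point of `g`. -/
theorem atop_prefixed {H : Type*} [HeytingAlgebra H]
    (g : H → H) (hmono : Monotone g)
    (hstrong : ∀ x y : H, x ⊓ g y ≤ g (x ⊓ y))
    (e f c x : H) (hc : g c ≤ c)
    (hfc : f ≤ c) (hcef : c ≤ e ⇨ f) (hcx : c ≤ x) (hxef : x ≤ e ⇨ f) :
    g ((x ⇨ e) ⇨ f) ≤ (x ⇨ e) ⇨ f := by
  rw [le_himp_iff, inf_comm]
  have h : (x ⇨ e) ⊓ g ((x ⇨ e) ⇨ f) ≤ c :=
    (hstrong _ _).trans <| (hmono <| inf_himp_le.trans hfc).trans hc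
  have he : (x ⇨ e) ⊓ g ((x ⇨ e) ⇨ f) ≤ e :=
    (le_inf (h.trans hcx) inf_le_left).trans inf_himp_le
  exact (le_inf he (h.trans hcef)).trans inf_himp_le
end

section
/- Let H be a Heyting algebra, I a finite index set, and (a_i)_{i∈I}, (b_i)_{i∈I} families of elements of H. Define φ : H → H by φ(x) = ⨆_{i∈I} ((x ⇨ a_i) ⇨ b_i). Then φ converges to its least fixed point in 3 steps: φ(φ³(⊥)) ≤ φ³(⊥), and hence φ³(⊥) is the least prefixed point (and least fixed point) of φ. -/
/-- The function `x ↦ (x ⇨ a) ⇨ b` is monotone. -/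
theorem himp_himp_mono {H : Type*} [HeytingAlgebra H] (a b : H) :
    Monotone fun x : H => (x ⇨ a) ⇨ b :=
  fun _ _ h => himp_le_himp_right (himp_le_himp_right h)

/-- To bound `c ⊓ ((v ⇨ a) ⇨ b)` by `(u ⇨ a) ⇨ b`, it is enough to derive `a` from `v` using the
remaining assumptions. -/
theorem inf_himp_himp_le {H : Type*} [HeytingAlgebra H] {a b c u v : H}
    (h : c ⊓ ((v ⇨ a) ⇨ b) ⊓ (u ⇨ a) ⊓ v ≤ a) : c ⊓ ((v ⇨ a) ⇨ b) ≤ (u ⇨ a) ⇨ b :=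
  le_himp_iff.2 <|
    (le_inf (inf_le_left.trans inf_le_right) (le_himp_iff.2 h)).trans himp_inf_le

/-- A finite disjunction of almost-topologies converges to its least fixed
point in 3 steps: with `φ x = ⨆ i, (x ⇨ a i) ⇨ b i`, the element `φ^[3] ⊥` is
a prefixed point of `φ`, and it is the least prefixed point and the least fixed
point of `φ`. -/
theorem atops_converge_in_three_steps {H : Type*} [HeytingAlgebra H]
    {I : Type*} [Fintype I] (a b : I → H)
    (φ : H → H) (hφ : ∀ x, φ x = Finset.univ.sup fun i => (x ⇨ a i) ⇨ b i) :
    φ (φ^[3] ⊥) ≤ φ^[3] ⊥ ∧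
      IsLeast {x : H | φ x ≤ x} (φ^[3] ⊥) ∧
      IsLeast {x : H | φ x = x} (φ^[3] ⊥) := by
  have hmono : Monotone φ := fun x y h => by
    rw [hφ, hφ]
    exact Finset.sup_mono_fun fun i _ => himp_himp_mono (a i) (b i) h
  have hj (i : I) (x : H) : (x ⇨ a i) ⇨ b i ≤ φ x := by
    rw [hφ]
    exact Finset.le_sup (f := fun i => (x ⇨ a i) ⇨ b i) (Finset.mem_univ i)
  have hb (i : I) : b i ≤ φ ⊥ := le_himp.trans (hj i ⊥)
  have hpre : φ (φ^[3] ⊥) ≤ φ^[3] ⊥ := by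
    change φ (φ (φ (φ ⊥))) ≤ φ (φ (φ ⊥))
    set B := φ ⊥
    set u := φ B
    rw [hφ (φ u)]
    refine Finset.sup_le fun i _ => le_trans ?_ (hj i u)
    suffices h : ⊤ ⊓ ((φ u ⇨ a i) ⇨ b i) ≤ (u ⇨ a i) ⇨ b i by rwa [top_inf_eq] at h
    apply inf_himp_himp_le
    rw [top_inf_eq]
    set c := ((φ u ⇨ a i) ⇨ b i) ⊓ (u ⇨ a i)
    have hcu : c ⊓ u ≤ B := by
      have ha : c ⊓ u ≤ a i := (inf_le_inf_right u inf_le_right).trans himp_inf_le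
      exact (le_inf (inf_le_left.trans inf_le_left) (ha.trans le_himp)).trans
        (himp_inf_le.trans (hb i))
    have hcv : c ⊓ φ u ≤ u := by
      rw [hφ u, Finset.sup_inf_distrib_left]
      refine Finset.sup_le fun k _ => (inf_himp_himp_le ?_).trans (hj k B)
      refine le_trans (le_inf (inf_le_left.trans inf_le_right) ?_) (himp_inf_le (a := B))
      exact (inf_le_inf_right u (inf_le_left.trans inf_le_left)).trans hcu
    exact (le_inf (inf_le_left.trans inf_le_right) hcv).trans himp_inf_le
  have hle {x : H} (hx : φ x ≤ x) : φ^[3] ⊥ ≤ x :=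
    (hmono ((hmono ((hmono bot_le).trans hx)).trans hx)).trans hx
  have hfix : φ (φ^[3] ⊥) = φ^[3] ⊥ :=
    le_antisymm hpre (hle (hmono hpre))
  exact ⟨hpre, ⟨hpre, fun _ hx => hle hx⟩, ⟨hfix, fun _ hx => hle (le_of_eq hx)⟩⟩
end
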